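/- arXiv:1808.07508 — 3 statements merged into one kernel-verified Lean document; each statement's English description precedes it below -/
import Mathlib

section
/- Let $R$ be a complete commutative noetherian local ring and $\Lambda$ a noetherian $R$-algebra (an $R$-algebra finitely generated as an $R$-module). If $A$ is a finitely generated indecomposable non-projective Gorenstein projective $\Lambda$-module and $0 \to \Omega A \to P \to A \to 0$ is exact with $P \to A$ a projective cover, then $\Omega A$ has no nonzero projective direct summand. -/
open LinearMap Function

/-- A bundled module over a ring `S`. -/
structure Mdl (S : Type) [Ring S] : Type 1 where
  carrier : Type
  [ag : AddCommGroup carrier]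
  [mod : Module S carrier]

attribute [instance] Mdl.ag Mdl.mod

instance {S : Type} [Ring S] : CoeSort (Mdl S) Type := ⟨Mdl.carrier⟩

/-- Bundle a module. -/
def Mdl.of (S : Type) [Ring S] (M : Type) [AddCommGroup M] [Module S M] : Mdl S := ⟨M⟩

section RingDefs

variable {S : Type} [Ring S]

/-- finitely generated projective -/
def FGProj (P : Mdl S) : Prop := Module.Projective S P.carrier ∧ Module.Finite S P.carrier

/-- superfluous (small) submodule -/
def Superfluous {P : Type} [AddCommGroup P] [Module S P] (K : Submodule S P) : Prop :=
  ∀ N : Submodule S P, N ⊔ K = ⊤ → N = ⊤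

/-- projective cover of a module -/
def IsProjCover {P M : Mdl S} (p : P.carrier →ₗ[S] M.carrier) : Prop :=
  FGProj P ∧ Function.Surjective p ∧ Superfluous (LinearMap.ker p)

/-- `N` is a (minimal) first syzygy of `M`. -/
def IsSyz1 (M N : Mdl S) : Prop :=
  ∃ (P : Mdl S) (p : P.carrier →ₗ[S] M.carrier),
    IsProjCover p ∧ Nonempty (N.carrier ≃ₗ[S] LinearMap.ker p)

/-- `N` is an `n`-th (minimal) syzygy of `M`. -/
def IsSyz (n : ℕ) (M N : Mdl S) : Prop :=
  ∃ F : Fin (n + 1) → Mdl S,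
    Nonempty ((F 0).carrier ≃ₗ[S] M.carrier) ∧
    Nonempty ((F (Fin.last n)).carrier ≃ₗ[S] N.carrier) ∧
    ∀ i : Fin n, IsSyz1 (F i.castSucc) (F i.succ)

/-- Gorenstein projective: a syzygy of a totally acyclic complex of
finitely generated projectives. -/
def IsGP (M : Mdl S) : Prop :=
  ∃ (P : ℤ → Mdl S) (d : ∀ i : ℤ, (P (i + 1)).carrier →ₗ[S] (P i).carrier),
    (∀ i, FGProj (P i)) ∧
    (∀ i, LinearMap.range (d (i + 1)) = LinearMap.ker (d i)) ∧
    (∀ (Q : Mdl S), Module.Projective S Q.carrier →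
      ∀ (i : ℤ) (g : (P (i + 1)).carrier →ₗ[S] Q.carrier), g ∘ₗ d (i + 1) = 0 →
        ∃ h : (P i).carrier →ₗ[S] Q.carrier, h ∘ₗ d i = g) ∧
    Nonempty (M.carrier ≃ₗ[S] LinearMap.ker (d 0))

/-- a map factoring through a projective module -/
def FactorsThruProj {A B : Mdl S} (φ : A.carrier →ₗ[S] B.carrier) : Prop :=
  ∃ (Q : Mdl S) (α : A.carrier →ₗ[S] Q.carrier) (β : Q.carrier →ₗ[S] B.carrier),
    Module.Projective S Q.carrier ∧ β ∘ₗ α = φ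

/-- `M` is stable: it has no nonzero projective direct summand. -/
def NoProjSummand (M : Mdl S) : Prop :=
  ∀ N Q : Mdl S, Nonempty (M.carrier ≃ₗ[S] (N.carrier × Q.carrier)) →
    Module.Projective S Q.carrier → Subsingleton Q.carrier

/-- indecomposable module -/
def IndecMod (M : Mdl S) : Prop :=
  Nontrivial M.carrier ∧
  ∀ N Q : Mdl S, Nonempty (M.carrier ≃ₗ[S] (N.carrier × Q.carrier)) →
    Subsingleton N.carrier ∨ Subsingleton Q.carrier

end RingDefs
section MorCat

variable {R : Type} [CommRing R]

/-- An object of the morphism category `𝓜`. -/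
structure MObj (R : Type) [CommRing R] : Type 1 where
  dom : Mdl R
  cod : Mdl R
  map : dom.carrier →ₗ[R] cod.carrier

/-- A morphism in the morphism category: a commutative square. -/
structure MHom (f g : MObj R) : Type where
  h1 : f.dom.carrier →ₗ[R] g.dom.carrier
  h2 : f.cod.carrier →ₗ[R] g.cod.carrier
  comm : g.map ∘ₗ h1 = h2 ∘ₗ f.map

/-- isomorphism in the morphism category -/
def MIso (f g : MObj R) : Prop :=
  ∃ (e1 : f.dom.carrier ≃ₗ[R] g.dom.carrier) (e2 : f.cod.carrier ≃ₗ[R] g.cod.carrier),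
    g.map ∘ₗ (e1 : f.dom.carrier →ₗ[R] g.dom.carrier)
      = (e2 : f.cod.carrier →ₗ[R] g.cod.carrier) ∘ₗ f.map

/-- epimorphism in the morphism category (componentwise surjective) -/
def MEpi {f g : MObj R} (φ : MHom f g) : Prop :=
  Function.Surjective φ.h1 ∧ Function.Surjective φ.h2

/-- projective object of the morphism category -/
def MProj (f : MObj R) : Prop :=
  ∀ (g h : MObj R) (e : MHom g h), MEpi e → ∀ φ : MHom f h,
    ∃ ψ : MHom f g, e.h1 ∘ₗ ψ.h1 = φ.h1 ∧ e.h2 ∘ₗ ψ.h2 = φ.h2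

/-- projective cover in the morphism category: a right minimal epimorphism
from a projective object -/
def MProjCover {q f : MObj R} (φ : MHom q f) : Prop :=
  MProj q ∧ MEpi φ ∧
  ∀ ξ : MHom q q, φ.h1 ∘ₗ ξ.h1 = φ.h1 → φ.h2 ∘ₗ ξ.h2 = φ.h2 →
    Function.Bijective ξ.h1 ∧ Function.Bijective ξ.h2

/-- `g` is a first syzygy of `f` in the morphism category. -/
def MSyz1 (f g : MObj R) : Prop :=
  ∃ (q : MObj R) (φ : MHom q f), MProjCover φ ∧
    ∃ k : (LinearMap.ker φ.h1 : Type) →ₗ[R] (LinearMap.ker φ.h2 : Type),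
      (LinearMap.ker φ.h2).subtype ∘ₗ k = q.map ∘ₗ (LinearMap.ker φ.h1).subtype ∧
      MIso g ⟨Mdl.of R (LinearMap.ker φ.h1), Mdl.of R (LinearMap.ker φ.h2), k⟩

/-- `g` is an `n`-th syzygy of `f` in the morphism category. -/
def MSyz (n : ℕ) (f g : MObj R) : Prop :=
  ∃ F : Fin (n + 1) → MObj R,
    MIso (F 0) f ∧ MIso (F (Fin.last n)) g ∧
    ∀ i : Fin n, MSyz1 (F i.castSucc) (F i.succ)

/-- `g` is the induced map on (minimal) first syzygies of the map `f`. -/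
def MapSyz1 (f g : MObj R) : Prop :=
  ∃ (PA PB : Mdl R) (pA : PA.carrier →ₗ[R] f.dom.carrier)
    (pB : PB.carrier →ₗ[R] f.cod.carrier) (L : PA.carrier →ₗ[R] PB.carrier),
    IsProjCover pA ∧ IsProjCover pB ∧ f.map ∘ₗ pA = pB ∘ₗ L ∧
    ∃ k : (LinearMap.ker pA : Type) →ₗ[R] (LinearMap.ker pB : Type),
      (LinearMap.ker pB).subtype ∘ₗ k = L ∘ₗ (LinearMap.ker pA).subtype ∧
      MIso g ⟨Mdl.of R (LinearMap.ker pA), Mdl.of R (LinearMap.ker pB), k⟩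

/-- `g` is the induced map on minimal `n`-th syzygies of the map `f`. -/
def MapSyz (n : ℕ) (f g : MObj R) : Prop :=
  ∃ F : Fin (n + 1) → MObj R,
    MIso (F 0) f ∧ MIso (F (Fin.last n)) g ∧
    ∀ i : Fin n, MapSyz1 (F i.castSucc) (F i.succ)

/-- direct sum in the morphism category -/
def DSum (f g : MObj R) : MObj R :=
  ⟨Mdl.of R (f.dom.carrier × g.dom.carrier), Mdl.of R (f.cod.carrier × g.cod.carrier),
    f.map.prodMap g.map⟩

/-- the zero object, up to iso -/
def MTrivial (f : MObj R) : Prop := Subsingleton f.dom.carrier ∧ Subsingleton f.cod.carrier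

/-- indecomposable object of the morphism category -/
def MIndec (f : MObj R) : Prop :=
  ¬ MTrivial f ∧ ∀ g h : MObj R, MIso f (DSum g h) → MTrivial g ∨ MTrivial h

/-- the endomorphism ring of `f` in the morphism category is local -/
def MEndLocal (f : MObj R) : Prop :=
  ¬ MTrivial f ∧
  ∀ ξ : MHom f f,
    (Function.Bijective ξ.h1 ∧ Function.Bijective ξ.h2) ∨
    (Function.Bijective ((LinearMap.id : f.dom.carrier →ₗ[R] f.dom.carrier) - ξ.h1) ∧
     Function.Bijective ((LinearMap.id : f.cod.carrier →ₗ[R] f.cod.carrier) - ξ.h2))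

/-- no nonzero projective direct summand in the morphism category -/
def MNoProjSummand (f : MObj R) : Prop :=
  ∀ g q : MObj R, MIso f (DSum g q) → MProj q → MTrivial q

/-- the cokernel module of an object -/
def CokMod (f : MObj R) : Mdl R := Mdl.of R (f.cod.carrier ⧸ LinearMap.range f.map)

/-- the cokernel object `Cok(f) : B → Cok f` -/
def CokObj (f : MObj R) : MObj R := ⟨f.cod, CokMod f, (LinearMap.range f.map).mkQ⟩

/-- Gorenstein projective objects of the morphism category -/
def InG (f : MObj R) : Prop :=
  Function.Injective f.map ∧ IsGP f.dom ∧ IsGP (CokMod f)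

/-- objects of `𝓗`: morphisms between Gorenstein projective modules -/
def InH (f : MObj R) : Prop := IsGP f.dom ∧ IsGP f.cod

/-- objects of `𝓔`: epimorphisms between Gorenstein projective modules -/
def InE (f : MObj R) : Prop := InH f ∧ Function.Surjective f.map

/-- `𝓖`-precover -/
def IsGPrecover {g x : MObj R} (φ : MHom g x) : Prop :=
  InG g ∧ ∀ g' : MObj R, InG g' → ∀ ψ : MHom g' x,
    ∃ ξ : MHom g' g, φ.h1 ∘ₗ ξ.h1 = ψ.h1 ∧ φ.h2 ∘ₗ ξ.h2 = ψ.h2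

/-- right minimal morphism -/
def MRightMin {g x : MObj R} (φ : MHom g x) : Prop :=
  ∀ ξ : MHom g g, φ.h1 ∘ₗ ξ.h1 = φ.h1 → φ.h2 ∘ₗ ξ.h2 = φ.h2 →
    Function.Bijective ξ.h1 ∧ Function.Bijective ξ.h2

/-- `𝓖`-cover -/
def IsGCover {g x : MObj R} (φ : MHom g x) : Prop := IsGPrecover φ ∧ MRightMin φ

/-- `𝓔`-preenvelope -/
def IsEPreenvelope {x e : MObj R} (φ : MHom x e) : Prop :=
  InE e ∧ ∀ e' : MObj R, InE e' → ∀ ψ : MHom x e',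
    ∃ ξ : MHom e e', ξ.h1 ∘ₗ φ.h1 = ψ.h1 ∧ ξ.h2 ∘ₗ φ.h2 = ψ.h2

/-- left minimal morphism -/
def MLeftMin {x e : MObj R} (φ : MHom x e) : Prop :=
  ∀ ξ : MHom e e, ξ.h1 ∘ₗ φ.h1 = φ.h1 → ξ.h2 ∘ₗ φ.h2 = φ.h2 →
    Function.Bijective ξ.h1 ∧ Function.Bijective ξ.h2

/-- `𝓔`-envelope -/
def IsEEnvelope {x e : MObj R} (φ : MHom x e) : Prop := IsEPreenvelope φ ∧ MLeftMin φ

/-- injective objects of `𝓗`: sums of `(P → P)` and `(P → 0)`,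
i.e. objects isomorphic to a projection `P × P' → P`. -/
def HInj (q : MObj R) : Prop :=
  ∃ P P' : Mdl R, FGProj P ∧ FGProj P' ∧
    MIso q ⟨Mdl.of R (P.carrier × P'.carrier), P, LinearMap.fst R P.carrier P'.carrier⟩

/-- no nonzero `𝓗`-injective direct summand -/
def MNoHInjSummand (f : MObj R) : Prop :=
  ∀ g q : MObj R, MIso f (DSum g q) → HInj q → MTrivial q

/-- `s` is (isomorphic to) the reduced `𝓖`-cover of `x` -/
def IsRedGCover (s x : MObj R) : Prop :=
  ∃ (g : MObj R) (φ : MHom g x), IsGCover φ ∧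
    ∃ q : MObj R, MProj q ∧ MIso g (DSum s q) ∧ MNoProjSummand s

/-- `s` is (isomorphic to) the reduced `𝓔`-envelope of `x` -/
def IsRedEEnvelope (s x : MObj R) : Prop :=
  ∃ (e : MObj R) (φ : MHom x e), IsEEnvelope φ ∧
    ∃ q : MObj R, HInj q ∧ MIso e (DSum s q) ∧ MNoHInjSummand s

/-- Auslander transpose of a module -/
def IsTranspose (M T : Mdl R) : Prop :=
  ∃ (P1 P0 : Mdl R) (d : P1.carrier →ₗ[R] P0.carrier) (p : P0.carrier →ₗ[R] M.carrier),
    FGProj P1 ∧ FGProj P0 ∧ Function.Surjective p ∧ Superfluous (LinearMap.ker p) ∧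
    LinearMap.range d = LinearMap.ker p ∧ Superfluous (LinearMap.ker d) ∧
    Nonempty (T.carrier ≃ₗ[R] (Module.Dual R P1.carrier ⧸ LinearMap.range d.dualMap))

/-- `L` is `λ M = Ω¹ Tr M`. -/
def LambdaOf (M L : Mdl R) : Prop := ∃ T : Mdl R, IsTranspose M T ∧ IsSyz1 T L

/-- horizontally linked module -/
def HorLinkedMod (M : Mdl R) : Prop :=
  ∃ L L2 : Mdl R, LambdaOf M L ∧ LambdaOf L L2 ∧ Nonempty (M.carrier ≃ₗ[R] L2.carrier)

/-- the Auslander transpose in the morphism category, computed by dualizing a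
(componentwise) minimal projective presentation
`(P₁ → P₁ ⊕ Q₁) → (P₀ → P₀ ⊕ Q₀) → f → 0` in `𝓜` against `𝐫 = (R → R ⊕ R)`. -/
def IsMTranspose (f t : MObj R) : Prop :=
  ∃ (P1 Q1 P0 Q0 : Mdl R)
    (u : P1.carrier →ₗ[R] P0.carrier)
    (v : (P1.carrier × Q1.carrier) →ₗ[R] (P0.carrier × Q0.carrier))
    (p : P0.carrier →ₗ[R] f.dom.carrier)
    (q : (P0.carrier × Q0.carrier) →ₗ[R] f.cod.carrier),
    FGProj P1 ∧ FGProj Q1 ∧ FGProj P0 ∧ FGProj Q0 ∧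
    v ∘ₗ LinearMap.inl R P1.carrier Q1.carrier = LinearMap.inl R P0.carrier Q0.carrier ∘ₗ u ∧
    q ∘ₗ LinearMap.inl R P0.carrier Q0.carrier = f.map ∘ₗ p ∧
    Function.Surjective p ∧ Function.Surjective q ∧
    Superfluous (LinearMap.ker p) ∧ Superfluous (LinearMap.ker q) ∧
    LinearMap.range u = LinearMap.ker p ∧ LinearMap.range v = LinearMap.ker q ∧
    Superfluous (LinearMap.ker u) ∧ Superfluous (LinearMap.ker v) ∧
    ∃ (e1 : t.dom.carrier ≃ₗ[R]
        (Module.Dual R Q1.carrier ⧸ LinearMap.range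
          (LinearMap.snd R P0.carrier Q0.carrier ∘ₗ v ∘ₗ
            LinearMap.inr R P1.carrier Q1.carrier).dualMap))
      (e2 : t.cod.carrier ≃ₗ[R]
        (Module.Dual R (P1.carrier × Q1.carrier) ⧸ LinearMap.range v.dualMap))
      (tt : (Module.Dual R Q1.carrier ⧸ LinearMap.range
          (LinearMap.snd R P0.carrier Q0.carrier ∘ₗ v ∘ₗ
            LinearMap.inr R P1.carrier Q1.carrier).dualMap) →ₗ[R]
        (Module.Dual R (P1.carrier × Q1.carrier) ⧸ LinearMap.range v.dualMap)),
      tt ∘ₗ (LinearMap.range (LinearMap.snd R P0.carrier Q0.carrier ∘ₗ v ∘ₗ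
          LinearMap.inr R P1.carrier Q1.carrier).dualMap).mkQ
        = (LinearMap.range v.dualMap).mkQ ∘ₗ (LinearMap.snd R P1.carrier Q1.carrier).dualMap ∧
      (e2 : t.cod.carrier →ₗ[R] _) ∘ₗ t.map = tt ∘ₗ (e1 : t.dom.carrier →ₗ[R] _)

/-- `g ≅ λ_𝓜 f = Ω¹_𝓜 Tr_𝓜 f` -/
def MLambda (f g : MObj R) : Prop := ∃ t : MObj R, IsMTranspose f t ∧ MSyz1 t g

/-- horizontally linked object of the submodule category -/
def MHorLinked (f : MObj R) : Prop :=
  ∃ g h : MObj R, MLambda f g ∧ MLambda g h ∧ MIso f h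

/-- the dual object `(B' → A')` of `(A → B)` -/
def DualObj (f : MObj R) : MObj R :=
  ⟨Mdl.of R (Module.Dual R f.cod.carrier), Mdl.of R (Module.Dual R f.dom.carrier), f.map.dualMap⟩

/-- componentwise short exact sequence in the morphism category -/
def MShortExact {a b c : MObj R} (φ : MHom a b) (ψ : MHom b c) : Prop :=
  Function.Injective φ.h1 ∧ Function.Injective φ.h2 ∧
  Function.Surjective ψ.h1 ∧ Function.Surjective ψ.h2 ∧
  LinearMap.range φ.h1 = LinearMap.ker ψ.h1 ∧
  LinearMap.range φ.h2 = LinearMap.ker ψ.h2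

/-- split monomorphism -/
def MSplitMono {a b : MObj R} (φ : MHom a b) : Prop :=
  ∃ σ : MHom b a, σ.h1 ∘ₗ φ.h1 = LinearMap.id ∧ σ.h2 ∘ₗ φ.h2 = LinearMap.id

/-- split epimorphism -/
def MSplitEpi {x c : MObj R} (θ : MHom x c) : Prop :=
  ∃ σ : MHom c x, θ.h1 ∘ₗ σ.h1 = LinearMap.id ∧ θ.h2 ∘ₗ σ.h2 = LinearMap.id

/-- almost split sequence in a full subcategory `C` of the morphism category -/
def IsAlmostSplitIn (C : MObj R → Prop) {a b c : MObj R}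
    (φ : MHom a b) (ψ : MHom b c) : Prop :=
  C a ∧ C b ∧ C c ∧ MShortExact φ ψ ∧ ¬ MSplitMono φ ∧ MEndLocal a ∧
  ∀ x : MObj R, C x → ∀ θ : MHom x c, ¬ MSplitEpi θ →
    ∃ ρ : MHom x b, ψ.h1 ∘ₗ ρ.h1 = θ.h1 ∧ ψ.h2 ∘ₗ ρ.h2 = θ.h2

end MorCat

/-- A Gorenstein local ring: noetherian local, and some fixed syzygy functor lands in
Gorenstein projective (maximal Cohen-Macaulay) modules. -/
def IsGorensteinLocal (R : Type) [CommRing R] : Prop :=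
  IsNoetherianRing R ∧ IsLocalRing R ∧
  ∃ n : ℕ, ∀ M : Mdl R, Module.Finite R M.carrier → ∀ N : Mdl R, IsSyz n M N → IsGP N


/-- A Gorenstein projective module is a quotient of a projective module along a map such that every
map from its kernel to a projective module extends. -/
lemma IsGP.exists_projective_extension {S : Type} [Ring S] {M : Mdl S} (hM : IsGP M) :
    ∃ (X : Mdl S) (q : X.carrier →ₗ[S] M.carrier), Module.Projective S X.carrier ∧
      Function.Surjective q ∧
      ∀ Q : Mdl S, Module.Projective S Q.carrier → ∀ f : LinearMap.ker q →ₗ[S] Q.carrier,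
        ∃ h : X.carrier →ₗ[S] Q.carrier, h ∘ₗ (LinearMap.ker q).subtype = f := by
  obtain ⟨P, d, hP, hex, htot, ⟨e⟩⟩ := hM
  have hmem (x) : d (0 + 1) x ∈ LinearMap.ker (d 0) := hex 0 ▸ LinearMap.mem_range_self _ x
  let q : (P (0 + 1 + 1)).carrier →ₗ[S] M.carrier :=
    e.symm.toLinearMap ∘ₗ (d (0 + 1)).codRestrict (LinearMap.ker (d 0)) hmem
  have hq (x) : q x = 0 ↔ d (0 + 1) x = 0 := by
    simp only [q, LinearMap.comp_apply, LinearEquiv.coe_coe, LinearEquiv.map_eq_zero_iff,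
      Subtype.ext_iff, LinearMap.codRestrict_apply, ZeroMemClass.coe_zero]
  refine ⟨P (0 + 1 + 1), q, (hP _).1, ?_, fun Q hQ f => ?_⟩
  · intro m
    obtain ⟨x, hx⟩ : (e m : (P (0 + 1)).carrier) ∈ LinearMap.range (d (0 + 1)) := by
      rw [hex 0]
      exact (e m).2
    refine ⟨x, e.injective (Subtype.ext ?_)⟩
    simpa [q] using hx
  · have hmem' (x) : d (0 + 1 + 1) x ∈ LinearMap.ker q := by
      rw [LinearMap.mem_ker, hq, ← LinearMap.mem_ker, ← hex (0 + 1)]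
      exact LinearMap.mem_range_self _ x
    obtain ⟨h, hh⟩ := htot Q hQ (0 + 1 + 1)
      (f ∘ₗ (d (0 + 1 + 1)).codRestrict (LinearMap.ker q) hmem') (by
        ext x
        have hx : d (0 + 1 + 1) (d (0 + 1 + 1 + 1) x) = 0 := by
          rw [← LinearMap.mem_ker, ← hex (0 + 1 + 1)]
          exact LinearMap.mem_range_self _ x
        have : (d (0 + 1 + 1)).codRestrict (LinearMap.ker q) hmem' (d (0 + 1 + 1 + 1) x) = 0 :=
          Subtype.ext hx
        simp only [LinearMap.comp_apply, this, map_zero, LinearMap.zero_apply])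
    refine ⟨h, LinearMap.ext fun ⟨y, hy⟩ => ?_⟩
    obtain ⟨x, rfl⟩ : y ∈ LinearMap.range (d (0 + 1 + 1)) := by
      rw [hex (0 + 1), LinearMap.mem_ker, ← hq]
      exact hy
    exact LinearMap.congr_fun hh x

/-- Maps from the kernel of a surjection of a projective module onto a Gorenstein projective module
to a projective module extend. -/
lemma IsGP.exists_extension {S : Type} [Ring S] {A P K Q : Mdl S} (hA : IsGP A)
    (hP : Module.Projective S P.carrier) (hQ : Module.Projective S Q.carrier)
    {p : P.carrier →ₗ[S] A.carrier} (hp : Function.Surjective p)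
    {i : K.carrier →ₗ[S] P.carrier} (hi : Function.Injective i)
    (hiK : LinearMap.range i = LinearMap.ker p) (f : K.carrier →ₗ[S] Q.carrier) :
    ∃ h : P.carrier →ₗ[S] Q.carrier, h ∘ₗ i = f := by
  obtain ⟨X, q, hX, hq, hext⟩ := hA.exists_projective_extension
  obtain ⟨a, ha⟩ := Module.projective_lifting_property q p hq
  obtain ⟨b, hb⟩ := Module.projective_lifting_property p q hp
  let r : LinearMap.ker p →ₗ[S] K.carrier :=
    (LinearEquiv.ofEq _ _ hiK.symm).trans (LinearEquiv.ofInjective i hi).symm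
  have hr (x : LinearMap.ker p) : i (r x) = x := by
    have := (LinearEquiv.ofInjective i hi).apply_symm_apply (LinearEquiv.ofEq _ _ hiK.symm x)
    exact congrArg Subtype.val this
  have hpa (x) : q (a x) = p x := LinearMap.congr_fun ha x
  have hqb (x) : p (b x) = q x := LinearMap.congr_fun hb x
  have hpi (k) : p (i k) = 0 := by
    rw [← LinearMap.mem_ker, ← hiK]
    exact LinearMap.mem_range_self _ k
  let b' : LinearMap.ker q →ₗ[S] LinearMap.ker p :=
    (b ∘ₗ (LinearMap.ker q).subtype).codRestrict _ fun x => by simp [hqb]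
  let c : P.carrier →ₗ[S] LinearMap.ker p :=
    (b ∘ₗ a - LinearMap.id).codRestrict _ fun x => by simp [hqb, hpa]
  obtain ⟨h, hh⟩ := hext Q hQ (f ∘ₗ r ∘ₗ b')
  refine ⟨h ∘ₗ a - f ∘ₗ r ∘ₗ c, LinearMap.ext fun k => ?_⟩
  have hk : a (i k) ∈ LinearMap.ker q := by rw [LinearMap.mem_ker, hpa, hpi]
  have h1 : h (a (i k)) = f (r (b' ⟨a (i k), hk⟩)) := LinearMap.congr_fun hh ⟨a (i k), hk⟩
  have h2 : r (b' ⟨a (i k), hk⟩) - r (c (i k)) = k := by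
    apply hi
    have h3 : (b' ⟨a (i k), hk⟩ : P.carrier) = b (a (i k)) := rfl
    have h4 : (c (i k) : P.carrier) = b (a (i k)) - i k := rfl
    rw [map_sub, hr, hr, h3, h4, sub_sub_cancel]
  simp only [LinearMap.comp_apply, LinearMap.sub_apply, h1, ← map_sub, h2]

theorem statement0 (R : Type) [CommRing R] [IsNoetherianRing R] [IsLocalRing R]
    [IsAdicComplete (IsLocalRing.maximalIdeal R) R]
    (Λ : Type) [Ring Λ] [Algebra R Λ] [Module.Finite R Λ]
    (A P K : Mdl Λ)
    (hfin : Module.Finite Λ A.carrier)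
    (hInd : IndecMod A) (hNonProj : ¬ Module.Projective Λ A.carrier) (hGP : IsGP A)
    (p : P.carrier →ₗ[Λ] A.carrier) (hp : IsProjCover p)
    (i : K.carrier →ₗ[Λ] P.carrier) (hi : Function.Injective i)
    (hiK : LinearMap.range i = LinearMap.ker p) :
    NoProjSummand K := by
  intro N Q ⟨e⟩ hQ
  obtain ⟨⟨hP, -⟩, hps, hsmall⟩ := hp
  obtain ⟨h, hh⟩ := hGP.exists_extension hP hQ hps hi hiK
    (LinearMap.snd Λ N.carrier Q.carrier ∘ₗ e.toLinearMap)
  have hsec (y : Q.carrier) : h (i (e.symm (0, y))) = y := by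
    simpa using LinearMap.congr_fun hh (e.symm (0, y))
  have htop : LinearMap.ker h = ⊤ := hsmall _ <| eq_top_iff.2 fun x _ => by
    have hx : x = (x - i (e.symm (0, h x))) + i (e.symm (0, h x)) := by abel
    rw [hx]
    refine Submodule.add_mem_sup ?_ (hiK ▸ LinearMap.mem_range_self _ _)
    simp [hsec]
  rw [LinearMap.ker_eq_top] at htop
  refine subsingleton_of_forall_eq 0 fun y => ?_
  rw [← hsec y, htop, LinearMap.zero_apply]
end

section
/- Let $R$ be a complete commutative noetherian local ring, $\Lambda$ a noetherian $R$-algebra, and $A$ an indecomposable non-projective Gorenstein projective $\Lambda$-module. Then the projectively stable endomorphism rings of $A$ and of its first syzygy are isomorphic: $\underline{\mathrm{End}}_\Lambda(A) \cong \underline{\mathrm{End}}_\Lambda(\Omega^1 A)$, and both are local rings. -/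
open LinearMap Function

/-- the projectively stable endomorphism ring -/
abbrev StableEnd (S : Type) [Ring S] (M : Mdl S) : Type :=
  RingQuot (fun φ ψ : Module.End S M.carrier => FactorsThruProj (A := M) (B := M) (φ - ψ))

section LocalEndomorphismRings

theorem isAdicComplete_of_moduleFinite {R M : Type*} [CommRing R] [IsNoetherianRing R]
    [IsLocalRing R] [IsAdicComplete (IsLocalRing.maximalIdeal R) R] [AddCommGroup M] [Module R M]
    [Module.Finite R M] : IsAdicComplete (IsLocalRing.maximalIdeal R) M where
  toIsPrecomplete := by
    rw [← AdicCompletion.of_surjective_iff]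
    intro x
    obtain ⟨t, rfl⟩ := AdicCompletion.ofTensorProduct_surjective_of_finite
      (IsLocalRing.maximalIdeal R) M x
    induction t with
    | zero => exact ⟨0, by simp⟩
    | add a b ha hb =>
      obtain ⟨u, hu⟩ := ha
      obtain ⟨v, hv⟩ := hb
      exact ⟨u + v, by rw [map_add, map_add, hu, hv]⟩
    | tmul r m =>
      obtain ⟨r, rfl⟩ := AdicCompletion.of_surjective (IsLocalRing.maximalIdeal R) R r
      refine ⟨r • m, ?_⟩
      rw [AdicCompletion.ofTensorProduct_tmul]
      rw [map_smul]
      exact (algebraMap_smul _ r _).symm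

theorem HenselianRing.exists_isIdempotentElem_mk_eq {S : Type*} [CommRing S] (I : Ideal S)
    [HenselianRing S I] {a : S} (ha : IsIdempotentElem (Ideal.Quotient.mk I a)) :
    ∃ e : S, IsIdempotentElem e ∧ Ideal.Quotient.mk I e = Ideal.Quotient.mk I a := by
  have ha' : a * a - a ∈ I := by
    rw [← Ideal.Quotient.eq, map_mul]
    exact ha
  obtain ⟨e, he, hea⟩ := HenselianRing.is_henselian (I := I)
    (Polynomial.X ^ 2 - Polynomial.X : Polynomial S) (Polynomial.monic_X_pow_sub
      (Polynomial.degree_X_le.trans_lt (by norm_num))) a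
    (by simpa [sq] using ha') (by
      have h : (2 * Ideal.Quotient.mk I a - 1) * (2 * Ideal.Quotient.mk I a - 1) = 1 := by
        linear_combination 4 * ha.eq
      have := IsUnit.of_mul_eq_one _ h
      simpa [one_add_one_eq_two, map_ofNat] using this)
  refine ⟨e, ?_, (Ideal.Quotient.eq).2 hea⟩
  have : e ^ 2 - e = 0 := by simpa [Polynomial.IsRoot] using he
  exact (sq e).symm.trans (sub_eq_zero.1 this)

theorem IsArtinianRing.isUnit_or_isUnit_one_sub {S : Type*} [CommRing S] [IsArtinianRing S]
    (h : ∀ e : S, IsIdempotentElem e → e = 0 ∨ e = 1) (x : S) : IsUnit x ∨ IsUnit (1 - x) := by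
  obtain ⟨n, y, hy⟩ := IsArtinian.exists_pow_succ_smul_dvd x (1 : S)
  simp only [smul_eq_mul, mul_one, Nat.succ_eq_add_one] at hy
  have hk : ∀ k, x ^ (n + k) * y ^ k = x ^ n := by
    intro k
    induction k with
    | zero => simp
    | succ k ih =>
      calc x ^ (n + (k + 1)) * y ^ (k + 1) = x ^ k * (x ^ (n + 1) * y) * y ^ k := by ring
        _ = x ^ (n + k) * y ^ k := by rw [hy]; ring
        _ = x ^ n := ih
  have he : IsIdempotentElem (x ^ n * y ^ n) := by
    calc x ^ n * y ^ n * (x ^ n * y ^ n) = x ^ (n + n) * y ^ n * y ^ n := by ring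
      _ = x ^ n * y ^ n := by rw [hk]
  rcases h _ he with h0 | h1
  · right
    have : x ^ n = 0 := by
      rw [← hk n, pow_add, mul_assoc, h0, mul_zero]
    exact IsNilpotent.isUnit_one_sub ⟨n, this⟩
  · rcases Nat.eq_zero_or_pos n with rfl | hn
    · left
      exact IsUnit.of_mul_eq_one y (by simpa using hy)
    · left
      exact (isUnit_pow_iff hn.ne').1 (IsUnit.of_mul_eq_one _ h1)

theorem isUnit_or_isUnit_one_sub_of_moduleFinite {R S : Type*} [CommRing R] [IsNoetherianRing R]
    [IsLocalRing R] [IsAdicComplete (IsLocalRing.maximalIdeal R) R] [CommRing S] [Algebra R S]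
    [Module.Finite R S] (h : ∀ e : S, IsIdempotentElem e → e = 0 ∨ e = 1) (x : S) :
    IsUnit x ∨ IsUnit (1 - x) := by
  let m := IsLocalRing.maximalIdeal R
  let I := m.map (algebraMap R S)
  have : IsAdicComplete I S :=
    (IsAdicComplete.map_algebraMap_iff m S).2 isAdicComplete_of_moduleFinite
  have : Module.Finite (R ⧸ m) (S ⧸ I) := Module.Finite.of_restrictScalars_finite R _ _
  let _ : Field (R ⧸ m) := Ideal.Quotient.field m
  have : IsArtinianRing (S ⧸ I) := IsArtinianRing.of_finite (R ⧸ m) (S ⧸ I)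
  have : IsLocalHom (Ideal.Quotient.mk I) :=
    isLocalHom_of_le_jacobson_bot I (IsAdicComplete.le_jacobson_bot I)
  have hq : ∀ e : S ⧸ I, IsIdempotentElem e → e = 0 ∨ e = 1 := by
    intro e he
    obtain ⟨a, rfl⟩ := Ideal.Quotient.mk_surjective e
    obtain ⟨b, hb, hba⟩ := HenselianRing.exists_isIdempotentElem_mk_eq I he
    rw [← hba]
    rcases h b hb with rfl | rfl <;> simp
  refine (IsArtinianRing.isUnit_or_isUnit_one_sub hq (Ideal.Quotient.mk I x)).imp
    (isUnit_of_map_unit _ x) fun hx => isUnit_of_map_unit (Ideal.Quotient.mk I) (1 - x) ?_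
  simpa using hx

open scoped IsMulCommutative in
theorem isLocalRing_of_moduleFinite_of_isIdempotentElem (R : Type*) {E : Type*} [CommRing R]
    [IsNoetherianRing R] [IsLocalRing R] [IsAdicComplete (IsLocalRing.maximalIdeal R) R] [Ring E]
    [Nontrivial E] [Algebra R E] [Module.Finite R E]
    (h : ∀ e : E, IsIdempotentElem e → e = 0 ∨ e = 1) : IsLocalRing E := by
  refine IsLocalRing.of_isUnit_or_isUnit_one_sub_self fun x => ?_
  let S := Algebra.adjoin R {x}
  have : IsMulCommutative S := Algebra.isMulCommutative_adjoin R (by simp)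
  have : Module.Finite R S := Module.IsNoetherian.finite R (Subalgebra.toSubmodule S)
  have hS : ∀ e : S, IsIdempotentElem e → e = 0 ∨ e = 1 := fun e he =>
    (h e (congrArg Subtype.val he)).imp (fun h => Subtype.ext h) fun h => Subtype.ext h
  exact (isUnit_or_isUnit_one_sub_of_moduleFinite (R := R) hS
    ⟨x, Algebra.self_mem_adjoin_singleton R x⟩).imp
    (fun hu => hu.map S.val) fun hu => hu.map S.val

theorem IsLocalRing.of_surjective_ringHom {E F : Type*} [Ring E] [IsLocalRing E] [Ring F]
    [Nontrivial F] (f : E →+* F) (hf : Function.Surjective f) : IsLocalRing F := by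
  refine IsLocalRing.of_isUnit_or_isUnit_one_sub_self fun b => ?_
  obtain ⟨a, rfl⟩ := hf b
  refine (IsLocalRing.isUnit_or_isUnit_of_add_one (add_sub_cancel a 1)).imp
    (fun h => h.map f) fun h => ?_
  simpa using h.map f

theorem moduleFinite_end (R Λ M : Type*) [CommRing R] [IsNoetherianRing R] [Ring Λ] [Algebra R Λ]
    [Module.Finite R Λ] [AddCommGroup M] [Module R M] [Module Λ M] [IsScalarTower R Λ M]
    [Module.Finite Λ M] : Module.Finite R (Module.End Λ M) := by
  have : Module.Finite R M := Module.Finite.trans Λ M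
  exact Module.Finite.of_injective (LinearMap.restrictScalarsₗ R Λ M M R)
    (LinearMap.restrictScalars_injective R)

theorem IndecMod.eq_zero_or_eq_one_of_isIdempotentElem {S : Type} [Ring S] {M : Mdl S}
    (hM : IndecMod M) (e : Module.End S M.carrier) (he : IsIdempotentElem e) : e = 0 ∨ e = 1 := by
  have hc := LinearMap.IsIdempotentElem.isCompl he
  refine (hM.2 (Mdl.of S e.range) (Mdl.of S e.ker)
    ⟨(Submodule.prodEquivOfIsCompl _ _ hc).symm⟩).imp (fun h => ?_) fun h => ?_
  · exact LinearMap.range_eq_bot.1 ((Submodule.subsingleton_iff_eq_bot).1 h)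
  · have hinj : Function.Injective e :=
      LinearMap.ker_eq_bot.1 ((Submodule.subsingleton_iff_eq_bot).1 h)
    ext x
    exact hinj (LinearMap.congr_fun he.eq x)

theorem IndecMod.isLocalRing_end (R : Type) {Λ : Type} [CommRing R] [IsNoetherianRing R]
    [IsLocalRing R] [IsAdicComplete (IsLocalRing.maximalIdeal R) R] [Ring Λ] [Algebra R Λ]
    [Module.Finite R Λ] {M : Mdl Λ} (hfin : Module.Finite Λ M.carrier) (hM : IndecMod M) :
    IsLocalRing (Module.End Λ M.carrier) := by
  let _ : Module R M.carrier := Module.compHom M.carrier (algebraMap R Λ)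
  have : IsScalarTower R Λ M.carrier := IsScalarTower.of_algebraMap_smul fun _ _ => rfl
  have := hM.1
  have := moduleFinite_end R Λ M.carrier
  exact isLocalRing_of_moduleFinite_of_isIdempotentElem R
    hM.eq_zero_or_eq_one_of_isIdempotentElem

end LocalEndomorphismRings

section StableEndomorphisms

variable {S : Type} [Ring S]

theorem factorsThruProj_zero {A B : Mdl S} :
    FactorsThruProj (A := A) (B := B) 0 :=
  ⟨Mdl.of S S, 0, 0, Module.Projective.of_free (R := S) (P := S), LinearMap.zero_comp _⟩

theorem FactorsThruProj.add {A B : Mdl S} {φ ψ : A.carrier →ₗ[S] B.carrier}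
    (hφ : FactorsThruProj φ) (hψ : FactorsThruProj ψ) : FactorsThruProj (φ + ψ) := by
  obtain ⟨Q, α, β, hQ, rfl⟩ := hφ
  obtain ⟨Q', α', β', hQ', rfl⟩ := hψ
  exact ⟨Mdl.of S (Q.carrier × Q'.carrier), α.prod α', β.coprod β',
    inferInstanceAs (Module.Projective S (Q.carrier × Q'.carrier)), by ext; rfl⟩

theorem FactorsThruProj.comp_left {A B C : Mdl S} {φ : A.carrier →ₗ[S] B.carrier}
    (hφ : FactorsThruProj φ) (χ : B.carrier →ₗ[S] C.carrier) :
    FactorsThruProj (A := A) (B := C) (χ ∘ₗ φ) := by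
  obtain ⟨Q, α, β, hQ, rfl⟩ := hφ
  exact ⟨Q, α, χ ∘ₗ β, hQ, rfl⟩

theorem FactorsThruProj.comp_right {A B C : Mdl S} {φ : B.carrier →ₗ[S] C.carrier}
    (hφ : FactorsThruProj φ) (χ : A.carrier →ₗ[S] B.carrier) :
    FactorsThruProj (A := A) (B := C) (φ ∘ₗ χ) := by
  obtain ⟨Q, α, β, hQ, rfl⟩ := hφ
  exact ⟨Q, α ∘ₗ χ, β, hQ, rfl⟩

theorem FactorsThruProj.neg {A B : Mdl S} {φ : A.carrier →ₗ[S] B.carrier}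
    (hφ : FactorsThruProj φ) : FactorsThruProj (-φ) := by
  obtain ⟨Q, α, β, hQ, rfl⟩ := hφ
  exact ⟨Q, α, -β, hQ, rfl⟩

/-- Congruence modulo the endomorphisms factoring through a projective module. -/
def stableCon (M : Mdl S) : RingCon (Module.End S M.carrier) where
  r φ ψ := FactorsThruProj (A := M) (B := M) (φ - ψ)
  iseqv :=
    { refl := fun φ => by simpa using factorsThruProj_zero
      symm := fun h => by simpa using h.neg
      trans := fun h h' => by simpa using h.add h' }
  add' h h' := by
    have := h.add h'
    rwa [sub_add_sub_comm] at this
  mul' {φ φ' ψ ψ'} h h' := by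
    have := (h'.comp_left φ).add (h.comp_right ψ')
    rwa [show φ * ψ - φ' * ψ' = φ ∘ₗ (ψ - ψ') + (φ - φ') ∘ₗ ψ' by
      ext; simp]

/-- The projection to the projectively stable endomorphism ring. -/
abbrev stableMk (M : Mdl S) : Module.End S M.carrier →+* StableEnd S M :=
  RingQuot.mkRingHom _

theorem stableMk_eq_iff {M : Mdl S} {φ ψ : Module.End S M.carrier} :
    stableMk M φ = stableMk M ψ ↔ FactorsThruProj (A := M) (B := M) (φ - ψ) := by
  refine ⟨fun h => ?_, fun h => RingQuot.mkRingHom_rel h⟩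
  let F : StableEnd S M →+* (stableCon M).Quotient :=
    RingQuot.lift ⟨(stableCon M).mk', fun x y hxy => (stableCon M).eq.2 hxy⟩
  have hF : ∀ x, F (stableMk M x) = (stableCon M).mk' x := fun x =>
    RingQuot.lift_mkRingHom_apply _ _ x
  exact (stableCon M).eq.1 ((hF φ).symm.trans ((congrArg F h).trans (hF ψ)))

theorem stableMk_eq_zero_iff {M : Mdl S} {φ : Module.End S M.carrier} :
    stableMk M φ = 0 ↔ FactorsThruProj (A := M) (B := M) φ := by
  rw [← map_zero (stableMk M), stableMk_eq_iff, sub_zero]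

theorem nontrivial_stableEnd {M : Mdl S} (hM : ¬ Module.Projective S M.carrier) :
    Nontrivial (StableEnd S M) := by
  refine ⟨1, 0, fun h => hM ?_⟩
  rw [← map_one (stableMk M), stableMk_eq_zero_iff] at h
  obtain ⟨Q, α, β, hQ, h⟩ := h
  exact Module.Projective.of_split α β h

end StableEndomorphisms

section Syzygies

variable {S : Type} [Ring S]

/-- Maps from `ker p` to projective modules extend along the inclusion; for `p` surjective from
a projective module this says that the cokernel satisfies `Ext¹(-, Q) = 0`. -/
def ExtendsToProj {P A : Type} [AddCommGroup P] [Module S P] [AddCommGroup A] [Module S A]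
    (p : P →ₗ[S] A) : Prop :=
  ∀ (Q : Mdl S), Module.Projective S Q.carrier → ∀ α : LinearMap.ker p →ₗ[S] Q.carrier,
    ∃ h : P →ₗ[S] Q.carrier, h ∘ₗ (LinearMap.ker p).subtype = α

theorem ExtendsToProj.of_surjective {P P' A : Type} [AddCommGroup P] [Module S P]
    [AddCommGroup P'] [Module S P'] [AddCommGroup A] [Module S A] [Module.Projective S P]
    [Module.Projective S P'] {p : P →ₗ[S] A} {q : P' →ₗ[S] A} (hp : Function.Surjective p)
    (hq : Function.Surjective q) (h : ExtendsToProj q) : ExtendsToProj p := by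
  intro Q hQ α
  obtain ⟨u, hu⟩ := Module.projective_lifting_property p q hp
  obtain ⟨v, hv⟩ := Module.projective_lifting_property q p hq
  have hu' : ∀ x, p (u x) = q x := LinearMap.congr_fun hu
  have hv' : ∀ x, q (v x) = p x := LinearMap.congr_fun hv
  let u' : LinearMap.ker q →ₗ[S] LinearMap.ker p :=
    u.restrict fun x hx => by simpa [hu'] using hx
  let w : P →ₗ[S] LinearMap.ker p :=
    (LinearMap.id - u ∘ₗ v).codRestrict _ fun x => by simp [hu', hv']
  obtain ⟨g, hg⟩ := h Q hQ (α ∘ₗ u')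
  refine ⟨g ∘ₗ v + α ∘ₗ w, LinearMap.ext fun k => ?_⟩
  have hk : q (v k) = 0 := by rw [hv']; exact k.2
  have hgk : g (v k) = α (u' ⟨v k, hk⟩) := LinearMap.congr_fun hg ⟨v k, hk⟩
  change g (v k) + α (w k) = α k
  rw [hgk, ← map_add]
  congr 1
  ext
  simp [u', w]

theorem IsGP.exists_extendsToProj {A : Mdl S} (hA : IsGP A) :
    ∃ (P : Mdl S) (q : P.carrier →ₗ[S] A.carrier), Module.Projective S P.carrier ∧
      Function.Surjective q ∧ ExtendsToProj q := by
  obtain ⟨P, d, hP, hd, hext, ⟨e⟩⟩ := hA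
  have hd0 : ∀ x, d (0 + 1) x ∈ LinearMap.ker (d 0) := fun x => by
    rw [← hd 0]; exact ⟨x, rfl⟩
  let q : (P (0 + 1 + 1)).carrier →ₗ[S] A.carrier := e.symm ∘ₗ (d (0 + 1)).codRestrict _ hd0
  have hq : LinearMap.ker q = LinearMap.ker (d (0 + 1)) := by
    rw [LinearEquiv.ker_comp, LinearMap.ker_codRestrict]
  refine ⟨P (0 + 1 + 1), q, (hP _).1, fun a => ?_, fun Q hQ α => ?_⟩
  · obtain ⟨x, hx⟩ : (e a : (P (0 + 1)).carrier) ∈ LinearMap.range (d (0 + 1)) :=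
      (hd 0).symm ▸ (e a).2
    refine ⟨x, e.injective (Subtype.ext ?_)⟩
    simpa [q] using hx
  · have hd1 : ∀ x, d (0 + 1 + 1) x ∈ LinearMap.ker q := fun x => by
      rw [hq, ← hd (0 + 1)]; exact ⟨x, rfl⟩
    obtain ⟨h, hh⟩ := hext Q hQ (0 + 1 + 1) (α ∘ₗ (d (0 + 1 + 1)).codRestrict _ hd1) (by
      ext x
      have hx : d (0 + 1 + 1) (d (0 + 1 + 1 + 1) x) = 0 := by
        have : d (0 + 1 + 1 + 1) x ∈ LinearMap.range (d (0 + 1 + 1 + 1)) := ⟨x, rfl⟩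
        rwa [hd] at this
      have : (d (0 + 1 + 1)).codRestrict _ hd1 (d (0 + 1 + 1 + 1) x) = 0 := Subtype.ext hx
      simp only [LinearMap.comp_apply, this, map_zero, LinearMap.zero_apply])
    refine ⟨h, LinearMap.ext fun k => ?_⟩
    obtain ⟨x, hx⟩ : (k : (P (0 + 1 + 1)).carrier) ∈ LinearMap.range (d (0 + 1 + 1)) :=
      ((hd (0 + 1)).trans hq.symm).symm ▸ k.2
    have hk : (d (0 + 1 + 1)).codRestrict _ hd1 x = k := Subtype.ext hx
    calc h k = h (d (0 + 1 + 1) x) := by rw [hx]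
      _ = α ((d (0 + 1 + 1)).codRestrict _ hd1 x) := LinearMap.congr_fun hh x
      _ = α k := by rw [hk]

variable {A P : Mdl S} (p : P.carrier →ₗ[S] A.carrier)

/-- Pairs of endomorphisms of `A` and of `ker p` which are induced by a common endomorphism of
the source of `p`. -/
def compatibleEnds :
    Subring (Module.End S A.carrier × Module.End S (LinearMap.ker p)) where
  carrier := {x | ∃ f : Module.End S P.carrier, p ∘ₗ f = x.1 ∘ₗ p ∧
    f ∘ₗ (LinearMap.ker p).subtype = (LinearMap.ker p).subtype ∘ₗ x.2}
  zero_mem' := ⟨0, by simp, by simp⟩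
  one_mem' := ⟨1, rfl, rfl⟩
  add_mem' := by
    rintro x y ⟨f, hf, hf'⟩ ⟨g, hg, hg'⟩
    exact ⟨f + g, by simp [LinearMap.comp_add, LinearMap.add_comp, hf, hg],
      by simp [LinearMap.comp_add, LinearMap.add_comp, hf', hg']⟩
  neg_mem' := by
    rintro x ⟨f, hf, hf'⟩
    exact ⟨-f, by simp [LinearMap.comp_neg, LinearMap.neg_comp, hf],
      by simp [LinearMap.comp_neg, LinearMap.neg_comp, hf']⟩
  mul_mem' := by
    rintro x y ⟨f, hf, hf'⟩ ⟨g, hg, hg'⟩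
    refine ⟨f ∘ₗ g, ?_, ?_⟩
    · rw [← LinearMap.comp_assoc, hf, LinearMap.comp_assoc, hg]; rfl
    · rw [LinearMap.comp_assoc, hg', ← LinearMap.comp_assoc, hf']; rfl

variable {p}

theorem exists_comp_eq_of_comp_subtype_eq_zero (hp : Function.Surjective p) {B : Type}
    [AddCommGroup B] [Module S B] (f : P.carrier →ₗ[S] B)
    (hf : f ∘ₗ (LinearMap.ker p).subtype = 0) : ∃ s : A.carrier →ₗ[S] B, s ∘ₗ p = f := by
  refine ⟨(LinearMap.ker p).liftQ f (fun x hx => LinearMap.congr_fun hf ⟨x, hx⟩) ∘ₗ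
    (p.quotKerEquivOfSurjective hp).symm, LinearMap.ext fun x => ?_⟩
  have : (p.quotKerEquivOfSurjective hp).symm (p x) = (LinearMap.ker p).mkQ x := by
    rw [LinearEquiv.symm_apply_eq]; rfl
  simp only [LinearMap.comp_apply, LinearEquiv.coe_coe, this]
  rfl

theorem exists_mem_compatibleEnds_left [Module.Projective S P.carrier]
    (hp : Function.Surjective p) (φ : Module.End S A.carrier) :
    ∃ ψ, (φ, ψ) ∈ compatibleEnds p := by
  obtain ⟨f, hf⟩ := Module.projective_lifting_property p (φ ∘ₗ p) hp
  have hf' : ∀ x, p (f x) = φ (p x) := LinearMap.congr_fun hf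
  exact ⟨f.restrict fun x hx => by
    rw [LinearMap.mem_ker, hf', LinearMap.mem_ker.1 hx, map_zero], f, hf, rfl⟩

theorem exists_mem_compatibleEnds_right [Module.Projective S P.carrier]
    (hp : Function.Surjective p) (hext : ExtendsToProj p)
    (ψ : Module.End S (LinearMap.ker p)) : ∃ φ, (φ, ψ) ∈ compatibleEnds p := by
  obtain ⟨f, hf⟩ := hext P inferInstance ((LinearMap.ker p).subtype ∘ₗ ψ)
  obtain ⟨φ, hφ⟩ := exists_comp_eq_of_comp_subtype_eq_zero hp (p ∘ₗ f) (by
    rw [LinearMap.comp_assoc, hf]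
    ext x
    exact (ψ x).2)
  exact ⟨φ, f, hφ.symm, hf⟩

theorem factorsThruProj_iff_of_mem_compatibleEnds [hP : Module.Projective S P.carrier]
    (hp : Function.Surjective p) (hext : ExtendsToProj p) {φ : Module.End S A.carrier}
    {ψ : Module.End S (LinearMap.ker p)} (h : (φ, ψ) ∈ compatibleEnds p) :
    FactorsThruProj (A := A) (B := A) φ ↔
      FactorsThruProj (A := Mdl.of S (LinearMap.ker p)) (B := Mdl.of S (LinearMap.ker p)) ψ := by
  obtain ⟨f, hf, hf'⟩ := h
  have hf₁ : ∀ x, p (f x) = φ (p x) := LinearMap.congr_fun hf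
  have hf₂ : ∀ k : LinearMap.ker p, f k = (ψ k : P.carrier) := LinearMap.congr_fun hf'
  constructor
  · rintro ⟨Q, α, β, hQ, rfl⟩
    obtain ⟨γ, hγ⟩ := Module.projective_lifting_property p β hp
    have hγ' : ∀ x, p (γ x) = β x := LinearMap.congr_fun hγ
    refine ⟨P, (LinearMap.ker p).subtype,
      (f - γ ∘ₗ α ∘ₗ p).codRestrict (LinearMap.ker p) fun x => by simp [hf₁, hγ'], hP,
      LinearMap.ext fun (k : LinearMap.ker p) => Subtype.ext ?_⟩
    have hk : p k = 0 := k.2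
    change f k - γ (α (p k)) = ψ k
    rw [hk, map_zero, map_zero, sub_zero, hf₂]
  · rintro ⟨Q, (α : LinearMap.ker p →ₗ[S] Q.carrier), (β : Q.carrier →ₗ[S] LinearMap.ker p), hQ, hβα⟩
    obtain ⟨α', hα'⟩ := hext Q hQ α
    have hα : ∀ k : LinearMap.ker p, α' k = α k := LinearMap.congr_fun hα'
    have hβ : ∀ k, β (α k) = ψ k := LinearMap.congr_fun hβα
    obtain ⟨s, hs⟩ := exists_comp_eq_of_comp_subtype_eq_zero hp
      (f - (LinearMap.ker p).subtype ∘ₗ β ∘ₗ α') (LinearMap.ext fun k => by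
        change f k - (β (α' k) : LinearMap.ker p) = (0 : P.carrier)
        rw [hα, hβ, hf₂, sub_self])
    refine ⟨P, s, p, hP, LinearMap.ext fun a => ?_⟩
    obtain ⟨x, rfl⟩ := hp a
    have hx : s (p x) = f x - (β (α' x) : LinearMap.ker p) := LinearMap.congr_fun hs x
    have h0 : p (β (α' x) : LinearMap.ker p) = 0 := (β (α' x)).2
    rw [LinearMap.comp_apply, hx, map_sub, h0, sub_zero, hf₁]

theorem nonempty_stableEnd_ringEquiv_ker [Module.Projective S P.carrier]
    (hp : Function.Surjective p) (hext : ExtendsToProj p) :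
    Nonempty (StableEnd S A ≃+* StableEnd S (Mdl.of S (LinearMap.ker p))) := by
  let K := Mdl.of S (LinearMap.ker p)
  let F : compatibleEnds p →+* StableEnd S A :=
    (stableMk A).comp ((RingHom.fst _ _).comp (compatibleEnds p).subtype)
  let G : compatibleEnds p →+* StableEnd S K :=
    (stableMk K).comp ((RingHom.snd _ _).comp (compatibleEnds p).subtype)
  have hF : Function.Surjective F := fun y => by
    obtain ⟨φ, rfl⟩ := RingQuot.mkRingHom_surjective _ y
    obtain ⟨ψ, h⟩ := exists_mem_compatibleEnds_left hp φ
    exact ⟨⟨_, h⟩, rfl⟩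
  have hG : Function.Surjective G := fun y => by
    obtain ⟨ψ, rfl⟩ := RingQuot.mkRingHom_surjective _ y
    obtain ⟨φ, h⟩ := exists_mem_compatibleEnds_right hp hext ψ
    exact ⟨⟨_, h⟩, rfl⟩
  have hker : RingHom.ker F = RingHom.ker G := by
    ext x
    exact stableMk_eq_zero_iff.trans
      ((factorsThruProj_iff_of_mem_compatibleEnds hp hext x.2).trans stableMk_eq_zero_iff.symm)
  exact ⟨(RingHom.quotientKerEquivOfSurjective hF).symm.trans
    ((Ideal.quotEquivOfEq hker).trans (RingHom.quotientKerEquivOfSurjective hG))⟩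

end Syzygies

theorem statement2 (R : Type) [CommRing R] [IsNoetherianRing R] [IsLocalRing R]
    [IsAdicComplete (IsLocalRing.maximalIdeal R) R]
    (Λ : Type) [Ring Λ] [Algebra R Λ] [Module.Finite R Λ]
    (A P : Mdl Λ)
    (hfin : Module.Finite Λ A.carrier)
    (hInd : IndecMod A) (hNonProj : ¬ Module.Projective Λ A.carrier) (hGP : IsGP A)
    (p : P.carrier →ₗ[Λ] A.carrier) (hp : IsProjCover p) :
    Nonempty (StableEnd Λ A ≃+* StableEnd Λ (Mdl.of Λ (LinearMap.ker p))) ∧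
    IsLocalRing (StableEnd Λ A) ∧ IsLocalRing (StableEnd Λ (Mdl.of Λ (LinearMap.ker p))) := by
  obtain ⟨⟨hP, -⟩, hsurj, -⟩ := hp
  obtain ⟨P', q, hP', hq, hext⟩ := hGP.exists_extendsToProj
  obtain ⟨e⟩ := nonempty_stableEnd_ringEquiv_ker hsurj (hext.of_surjective hsurj hq)
  have := hInd.isLocalRing_end R hfin
  have := nontrivial_stableEnd hNonProj
  have hloc : IsLocalRing (StableEnd Λ A) :=
    .of_surjective_ringHom (stableMk A) (RingQuot.mkRingHom_surjective _)
  have : Nontrivial (StableEnd Λ (Mdl.of Λ (LinearMap.ker p))) := e.injective.nontrivial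
  exact ⟨⟨e⟩, hloc, .of_surjective_ringHom e.toRingHom e.surjective⟩
end

section
/- Let $R$ be a commutative noetherian local ring and let $0 \to A \xrightarrow{f} B \xrightarrow{g} C \to 0$ be a short exact sequence of finitely generated $R$-modules. If $u: P_0 \to A$ and $v: Q_0 \to C$ are projective covers, and $w: Q_0 \to B$ lifts $v$ along $g$, then $(P_0 \xrightarrow{[1\ 0]^t} P_0 \oplus Q_0) \to (A \xrightarrow{f} B)$ given by $(u, [fu\ \ w])$ is a projective cover of the object $f$ in the morphism category $\mathcal{M}$. Consequently $\Omega^1_{\mathcal{M}}(f) = (\Omega^1 A \to \Omega^1 B \oplus Q)$ for some projective $R$-module $Q$, with first component the minimal first syzygy of $A$. -/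
open LinearMap Function

/-- A map is surjective if its composite with a map with superfluous kernel is surjective. -/
theorem surjective_of_surjective_comp_of_superfluous {S : Type} [Ring S] {F P M : Type}
    [AddCommGroup F] [Module S F] [AddCommGroup P] [Module S P] [AddCommGroup M] [Module S M]
    {p : P →ₗ[S] M} (hp : Superfluous (LinearMap.ker p)) (a : F →ₗ[S] P)
    (ha : Function.Surjective (p ∘ₗ a)) : Function.Surjective a := by
  rw [← LinearMap.range_eq_top]
  refine hp _ (eq_top_iff.2 fun x _ => ?_)
  obtain ⟨y, hy⟩ := ha (p x)
  refine Submodule.mem_sup.2 ⟨a y, ⟨y, rfl⟩, x - a y, ?_, by abel⟩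
  simpa [sub_eq_zero] using hy.symm

open scoped TensorProduct in
/-- Finitely generated modules over a local ring have projective covers. -/
theorem exists_isProjCover {R : Type} [CommRing R] [IsLocalRing R] (M : Mdl R)
    [Module.Finite R M.carrier] :
    ∃ (P : Mdl R) (p : P.carrier →ₗ[R] M.carrier), IsProjCover p := by
  let k := IsLocalRing.ResidueField R
  let b := Module.finBasis k (TensorProduct R k M.carrier)
  have hf : ∀ i, ∃ m : M.carrier, (1 : k) ⊗ₜ[R] m = b i := fun i =>
    TensorProduct.mk_surjective R M.carrier k IsLocalRing.residue_surjective (b i)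
  choose f hf using hf
  let p := Fintype.linearCombination R f
  have hker : LinearMap.ker p ≤ IsLocalRing.maximalIdeal R • ⊤ := by
    intro x hx
    have hx0 : ∑ i, x i • f i = 0 := by
      simpa [p, Fintype.linearCombination_apply] using hx
    have hsum : ∑ i, IsLocalRing.residue R (x i) • b i = 0 := by
      have h := congrArg (fun m => (1 : k) ⊗ₜ[R] m) hx0
      simp only [TensorProduct.tmul_sum, TensorProduct.tmul_smul, hf,
        TensorProduct.tmul_zero] at h
      rw [← h]
      exact Finset.sum_congr rfl fun i _ => algebraMap_smul k (x i) (b i)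
    have hli := Fintype.linearIndependent_iff.1 b.linearIndependent _ hsum
    rw [← Finset.univ_sum_single x]
    refine Submodule.sum_mem _ fun i _ => ?_
    have : Pi.single i (x i) = x i • (Pi.single i 1 : _ → R) := by
      rw [← Pi.single_smul]; simp
    rw [this]
    exact Submodule.smul_mem_smul ((IsLocalRing.residue_eq_zero_iff _).1 (hli i)) trivial
  have hsurj : Function.Surjective p := by
    rw [← LinearMap.range_eq_top, Fintype.range_linearCombination]
    exact IsLocalRing.span_eq_top_of_tmul_eq_basis f b hf
  have hsup : Superfluous (LinearMap.ker p) := fun N hN =>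
    eq_top_iff.2 <| Submodule.le_of_le_smul_of_le_jacobson_bot
      (I := IsLocalRing.maximalIdeal R) Module.Finite.fg_top
      (IsLocalRing.maximalIdeal_le_jacobson _) (hN.ge.trans (sup_le_sup_left hker N))
  exact ⟨Mdl.of R (Fin _ → R), p, ⟨inferInstanceAs (Module.Projective R (Fin _ → R)),
    inferInstanceAs (Module.Finite R (Fin _ → R))⟩, hsurj, hsup⟩

/-- The kernel of a surjection from a finitely generated projective module is the minimal
first syzygy up to a finitely generated projective summand. -/
theorem exists_ker_equiv_syz_prod {R : Type} [CommRing R] [IsNoetherianRing R] [IsLocalRing R]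
    {F M : Mdl R} (hF : FGProj F) (q : F.carrier →ₗ[R] M.carrier)
    (hq : Function.Surjective q) :
    ∃ Q N : Mdl R, FGProj Q ∧ IsSyz1 M N ∧
      Nonempty (LinearMap.ker q ≃ₗ[R] (N.carrier × Q.carrier)) := by
  have := hF.1
  have := hF.2
  have : Module.Finite R M.carrier := Module.Finite.of_surjective q hq
  obtain ⟨P, p, hp⟩ := exists_isProjCover M
  have := hp.1.1
  obtain ⟨a, ha⟩ := Module.projective_lifting_property p q hp.2.1
  have hpa : ∀ x, p (a x) = q x := fun x => LinearMap.congr_fun ha x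
  have hsurj : Function.Surjective a :=
    surjective_of_surjective_comp_of_superfluous hp.2.2 a (by rwa [ha])
  obtain ⟨s, hs⟩ := Module.projective_lifting_property a LinearMap.id hsurj
  have has : ∀ y, a (s y) = y := fun y => LinearMap.congr_fun hs y
  have hretr : ∀ x, x - s (a x) ∈ LinearMap.ker a := fun x => by simp [has]
  have hproj : Module.Projective R (LinearMap.ker a) := by
    refine Module.Projective.of_split (LinearMap.ker a).subtype
      ((LinearMap.id - s ∘ₗ a).codRestrict _ hretr) ?_
    ext x
    simp
  let toProd : LinearMap.ker q →ₗ[R] LinearMap.ker p × LinearMap.ker a :=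
    LinearMap.prod
      ((a ∘ₗ (LinearMap.ker q).subtype).codRestrict _ fun x => by simp [hpa])
      (((LinearMap.id - s ∘ₗ a) ∘ₗ (LinearMap.ker q).subtype).codRestrict _ fun x => hretr x)
  let ofProd : LinearMap.ker p × LinearMap.ker a →ₗ[R] LinearMap.ker q :=
    (LinearMap.coprod (s ∘ₗ (LinearMap.ker p).subtype)
      (LinearMap.ker a).subtype).codRestrict _ fun x => by simp [← hpa, has]
  have hto : toProd ∘ₗ ofProd = LinearMap.id := by
    refine LinearMap.ext fun x => Prod.ext (Subtype.ext ?_) (Subtype.ext ?_)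
    · change a (s x.1 + x.2) = x.1
      simp [has]
    · change (s x.1 + x.2 : F.carrier) - s (a (s x.1 + x.2)) = x.2
      simp [has]
  have hof : ofProd ∘ₗ toProd = LinearMap.id :=
    LinearMap.ext fun x => Subtype.ext (add_sub_cancel (s (a x)) (x : F.carrier))
  exact ⟨Mdl.of R (LinearMap.ker a), Mdl.of R (LinearMap.ker p),
    ⟨hproj, inferInstanceAs (Module.Finite R (LinearMap.ker a))⟩,
    ⟨P, p, hp, ⟨LinearEquiv.refl R _⟩⟩, ⟨LinearEquiv.ofLinearMap toProd ofProd hto hof⟩⟩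

/-- The inclusion of a summand into a direct sum of projective modules is a projective object
of the morphism category. -/
theorem mProj_inl {R : Type} [CommRing R] (P Q : Mdl R) [Module.Projective R P.carrier]
    [Module.Projective R Q.carrier] :
    MProj (⟨P, Mdl.of R (P.carrier × Q.carrier), LinearMap.inl R P.carrier Q.carrier⟩ :
      MObj R) := by
  intro g h e he φ
  obtain ⟨a, ha⟩ := Module.projective_lifting_property e.h1 φ.h1 he.1
  obtain ⟨b, hb⟩ := Module.projective_lifting_property e.h2
    (φ.h2 ∘ₗ LinearMap.inr R P.carrier Q.carrier) he.2
  refine ⟨⟨a, LinearMap.coprod (g.map ∘ₗ a) b, (LinearMap.coprod_inl _ _).symm⟩, ha, ?_⟩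
  have hcoprod : φ.h2 = LinearMap.coprod (h.map ∘ₗ φ.h1)
      (φ.h2 ∘ₗ LinearMap.inr R P.carrier Q.carrier) := by
    rw [φ.comm]
    exact (LinearMap.coprod_comp_inl_inr _).symm
  rw [hcoprod, ← hb, ← ha, ← LinearMap.comp_assoc, e.comm, LinearMap.comp_assoc]
  exact LinearMap.comp_coprod _ _ _

theorem statement4 (R : Type) [CommRing R] [IsNoetherianRing R] [IsLocalRing R]
    (A B C P0 Q0 : Mdl R)
    (hA : Module.Finite R A.carrier) (hB : Module.Finite R B.carrier)
    (hC : Module.Finite R C.carrier)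
    (fm : A.carrier →ₗ[R] B.carrier) (gm : B.carrier →ₗ[R] C.carrier)
    (hmono : Function.Injective fm) (hepi : Function.Surjective gm)
    (hex : LinearMap.range fm = LinearMap.ker gm)
    (u : P0.carrier →ₗ[R] A.carrier) (hu : IsProjCover u)
    (v : Q0.carrier →ₗ[R] C.carrier) (hv : IsProjCover v)
    (w : Q0.carrier →ₗ[R] B.carrier) (hw : gm ∘ₗ w = v) :
    (∃ φ : MHom (⟨P0, Mdl.of R (P0.carrier × Q0.carrier),
        LinearMap.inl R P0.carrier Q0.carrier⟩ : MObj R) (⟨A, B, fm⟩ : MObj R),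
        φ.h1 = u ∧ φ.h2 = LinearMap.coprod (fm ∘ₗ u) w) ∧
    ∀ φ : MHom (⟨P0, Mdl.of R (P0.carrier × Q0.carrier),
        LinearMap.inl R P0.carrier Q0.carrier⟩ : MObj R) (⟨A, B, fm⟩ : MObj R),
      φ.h1 = u → φ.h2 = LinearMap.coprod (fm ∘ₗ u) w →
      MProjCover φ ∧
      ∃ (Q ΩB : Mdl R) (e : (LinearMap.ker u : Type) →ₗ[R] (ΩB.carrier × Q.carrier)),
        FGProj Q ∧ IsSyz1 B ΩB ∧
        ∃ k : (LinearMap.ker φ.h1 : Type) →ₗ[R] (LinearMap.ker φ.h2 : Type),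
          (LinearMap.ker φ.h2).subtype ∘ₗ k
            = LinearMap.inl R P0.carrier Q0.carrier ∘ₗ (LinearMap.ker φ.h1).subtype ∧
          MIso ⟨Mdl.of R (LinearMap.ker φ.h1), Mdl.of R (LinearMap.ker φ.h2), k⟩
               ⟨Mdl.of R (LinearMap.ker u), Mdl.of R (ΩB.carrier × Q.carrier), e⟩ := by
  have := hu.1.1
  have := hu.1.2
  have := hv.1.1
  have := hv.1.2
  have hgf : ∀ a, gm (fm a) = 0 := fun a =>
    LinearMap.mem_ker.1 (hex ▸ LinearMap.mem_range_self fm a)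
  have hgw : ∀ y, gm (w y) = v y := fun y => LinearMap.congr_fun hw y
  refine ⟨⟨⟨u, LinearMap.coprod (fm ∘ₗ u) w, (LinearMap.coprod_inl _ _).symm⟩, rfl, rfl⟩, ?_⟩
  rintro ⟨h1, h2, comm⟩ hh1 hh2
  change h1 = u at hh1
  change h2 = LinearMap.coprod (fm ∘ₗ u) w at hh2
  subst h1 h2
  have hsurj : Function.Surjective (LinearMap.coprod (fm ∘ₗ u) w) := by
    intro b
    obtain ⟨y, hy⟩ := hv.2.1 (gm b)
    have hmem : b - w y ∈ LinearMap.range fm := by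
      rw [hex]; simp [hgw, hy]
    obtain ⟨a, ha⟩ := hmem
    obtain ⟨x, rfl⟩ := hu.2.1 a
    exact ⟨(x, y), by simp [ha]⟩
  refine ⟨⟨mProj_inl P0 Q0, ⟨hu.2.1, hsurj⟩, ?_⟩, ?_⟩
  · rintro ⟨ξ1, ξ2, hξ⟩ e1 e2
    change P0.carrier × Q0.carrier →ₗ[R] P0.carrier × Q0.carrier at ξ2
    change u ∘ₗ ξ1 = u at e1
    change LinearMap.coprod (fm ∘ₗ u) w ∘ₗ ξ2 = LinearMap.coprod (fm ∘ₗ u) w at e2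
    have s1 : Function.Surjective ξ1 :=
      surjective_of_surjective_comp_of_superfluous hu.2.2 ξ1 (by rw [e1]; exact hu.2.1)
    have s2 : Function.Surjective
        (LinearMap.snd R P0.carrier Q0.carrier ∘ₗ ξ2 ∘ₗ
          LinearMap.inr R P0.carrier Q0.carrier) := by
      refine surjective_of_surjective_comp_of_superfluous hv.2.2 _ ?_
      convert hv.2.1 using 2
      ext y
      have h := congrArg gm (LinearMap.congr_fun e2 (0, y))
      simpa [hgf, hgw] using h
    have hinl : ∀ x, ξ2 (x, 0) = (ξ1 x, 0) := fun x => (LinearMap.congr_fun hξ x).symm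
    have s3 : Function.Surjective ξ2 := by
      rintro ⟨p, q⟩
      obtain ⟨y, hy⟩ := s2 q
      obtain ⟨x, hx⟩ := s1 (p - (ξ2 (0, y)).1)
      refine ⟨(x, 0) + (0, y), ?_⟩
      rw [map_add, hinl, hx]
      exact Prod.ext (by simp) (by simpa using hy)
    exact ⟨⟨OrzechProperty.injective_of_surjective_endomorphism ξ1 s1, s1⟩,
      ⟨OrzechProperty.injective_of_surjective_endomorphism ξ2 s3, s3⟩⟩
  · obtain ⟨Q, N, hQ, hN, ⟨E⟩⟩ := exists_ker_equiv_syz_prod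
      (F := Mdl.of R (P0.carrier × Q0.carrier))
      ⟨inferInstanceAs (Module.Projective R (P0.carrier × Q0.carrier)),
        inferInstanceAs (Module.Finite R (P0.carrier × Q0.carrier))⟩
      (LinearMap.coprod (fm ∘ₗ u) w) hsurj
    let k : LinearMap.ker u →ₗ[R] LinearMap.ker (LinearMap.coprod (fm ∘ₗ u) w) :=
      (LinearMap.inl R P0.carrier Q0.carrier ∘ₗ (LinearMap.ker u).subtype).codRestrict _
        fun x => by simp
    exact ⟨Q, N, E.toLinearMap ∘ₗ k, hQ, hN, k, rfl, LinearEquiv.refl R _, E, rfl⟩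
end
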